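/- arXiv:2405.01399 — 6 statements merged into one kernel-verified Lean document; each statement's English description precedes it below -/
import Mathlib

section
/- Let M be an additive commutative group, f : M → M an additive map, S ⊆ M a finite set with |S| = h, and u ∈ M. Suppose that the image of S under f equals the translate of S by u, i.e. f(S) = {s + u : s ∈ S} as sets. Then for every s ∈ S, f^{h!}(s) = s + ∑_{i=0}^{h!−1} f^{i}(u), where f^{i} denotes the i-fold iterate of f. -/
/-- A surjective self-map of a finite type has its `(card α)!`-th iterate equal to the identity. -/
theorem Function.Surjective.iterate_factorial_card {α : Type*} [Fintype α] {g : α → α}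
    (hg : g.Surjective) : g^[(Fintype.card α).factorial] = id := by
  classical
  let e : Equiv.Perm α := Equiv.ofBijective g (Finite.surjective_iff_bijective.mp hg)
  have he : e ^ (Fintype.card α).factorial = 1 := by
    rw [← Fintype.card_perm, pow_card_eq_one]
  have h := Equiv.Perm.iterate_eq_pow e (Fintype.card α).factorial
  rw [he] at h
  exact h

/-- If `S ⊆ g(S)` and `g(S) ⊆ S` for a finite set `S`, then the `|S|!`-th iterate of `g` fixes `S`
pointwise. -/
theorem Finset.iterate_factorial_card_eq_self {α : Type*} {g : α → α} {S : Finset α}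
    (hmaps : Set.MapsTo g S S) (hsurj : Set.SurjOn g S S) {s : α} (hs : s ∈ S) :
    g^[S.card.factorial] s = s := by
  have h : (hmaps.restrict g S S)^[(Fintype.card (S : Set α)).factorial] = id :=
    (hmaps.restrict_surjective_iff.mpr hsurj).iterate_factorial_card
  have hs' := congrArg Subtype.val (congrFun h ⟨s, hs⟩)
  simpa [hmaps.iterate_restrict] using hs'

/-- Iterates of an additive map in terms of iterates of its translate by `-u`. -/
theorem AddMonoidHom.iterate_eq_iterate_sub_add_sum {M : Type*} [AddCommGroup M] (f : M →+ M)
    (u x : M) (n : ℕ) :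
    f^[n] x = (fun y => f y - u)^[n] x + ∑ i ∈ Finset.range n, f^[i] u := by
  induction n with
  | zero => simp
  | succ n ih =>
    simp only [Function.iterate_succ_apply', ih, map_add, map_sum, Finset.sum_range_succ',
      Function.iterate_zero_apply]
    abel


/-- **Support-permutation iteration.** If `f : M → M` is an additive map of an additive
commutative group, `S` is a finite subset of `M` with `h = |S|` elements, `u ∈ M`, and the
image of `S` under `f` equals the translate `S + u`, then for every `s ∈ S` we have
`f^[h!] s = s + ∑_{i=0}^{h!-1} f^[i] u`. -/
theorem iterate_factorial_of_image_eq_translate {M : Type*} [AddCommGroup M]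
    [DecidableEq M] (f : M →+ M) (S : Finset M) (u : M)
    (hfS : S.image ⇑f = S.image (fun s => s + u)) :
    ∀ s ∈ S, (⇑f)^[Nat.factorial S.card] s =
      s + ∑ i ∈ Finset.range (Nat.factorial S.card), (⇑f)^[i] u := by
  intro s hs
  have hmaps : Set.MapsTo (fun y => f y - u) S S := by
    intro x hx
    obtain ⟨t, ht, htx⟩ := Finset.mem_image.mp (hfS ▸ Finset.mem_image_of_mem f hx)
    simpa [← htx] using ht
  have hsurj : Set.SurjOn (fun y => f y - u) S S := by
    intro t ht
    obtain ⟨x, hx, hxt⟩ := Finset.mem_image.mp (hfS ▸ Finset.mem_image_of_mem (· + u) ht)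
    exact ⟨x, hx, by simp [hxt]⟩
  rw [f.iterate_eq_iterate_sub_add_sum u, Finset.iterate_factorial_card_eq_self hmaps hsurj hs]
end

section
/- Let K be a field of characteristic 0 and n a natural number. Let c : (Fin n → ℤ) →₀ K[X] be a finitely supported family of univariate polynomials over K (the coefficient family of a Laurent polynomial in Y₁,…,Yₙ over K[X]) such that c_t is a non-constant polynomial for at least one index t. Let N : (Fin n → ℤ) → (Fin n → ℤ) be an injective additive map, u ∈ (Fin n → ℤ), γ : Fin n → Kˣ, ξ ∈ Kˣ, and β ∈ K. Suppose that for every t : Fin n → ℤ one has (∏ᵢ γᵢ^{tᵢ}) • (c_t composed with X + β) = ξ • c_{N(t) + u} as an equality in K[X], where γᵢ^{tᵢ} denotes an integer power in Kˣ and c_t composed with X + β is the polynomial c_t(X + β). Then β = 0. -/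
open Polynomial in
/-- A non-constant polynomial over a field of characteristic `0` that is fixed by the
translation `X ↦ X + δ` can only be fixed by the trivial translation. -/
lemma Polynomial.eq_zero_of_comp_X_add_C_eq_self {K : Type*} [Field K] [CharZero K]
    {p : K[X]} (hp : 0 < p.natDegree) {δ : K} (h : p.comp (X + C δ) = p) : δ = 0 := by
  by_contra hδ
  have heval (k : ℕ) : p.eval (k * δ) = p.eval 0 := by
    induction k with
    | zero => simp
    | succ k ih =>
      rw [← ih]
      conv_rhs => rw [← h]
      simp [add_mul]
  have hconst : p = C (p.eval 0) := by
    apply eq_of_infinite_eval_eq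
    refine (Set.infinite_range_of_injective (f := fun k : ℕ => (k : K) * δ) ?_).mono ?_
    · exact (mul_left_injective₀ hδ).comp Nat.cast_injective
    · rintro _ ⟨k, rfl⟩
      simp [heval k]
  rw [hconst, natDegree_C] at hp
  exact hp.false

open Polynomial in
/-- A non-constant polynomial over a field of characteristic `0` that is fixed up to a scalar
by the translation `X ↦ X + δ` can only be so for the trivial translation. -/
lemma Polynomial.eq_zero_of_eq_smul_comp_X_add_C {K : Type*} [Field K] [CharZero K]
    {p : K[X]} (hp : 0 < p.natDegree) {a δ : K} (h : p = a • p.comp (X + C δ)) : δ = 0 := by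
  have hp0 : p.leadingCoeff ≠ 0 := leadingCoeff_ne_zero.mpr (ne_zero_of_natDegree_gt hp)
  have ha : a = 1 := by
    have hlead := congrArg leadingCoeff h
    rw [smul_eq_C_mul, leadingCoeff_mul, leadingCoeff_C, leadingCoeff_comp (by simp),
      leadingCoeff_X_add_C, one_pow, mul_one] at hlead
    exact (mul_eq_right₀ hp0).mp hlead.symm
  rw [ha, one_smul] at h
  exact eq_zero_of_comp_X_add_C_eq_self hp h.symm

open Polynomial in
/-- If a self-map `f` of the index set acts on a family of polynomials by translation by `β`
up to nonzero scalars, then `f^[k]` acts by translation by `k * β` up to nonzero scalars. -/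
lemma Polynomial.exists_iterate_eq_smul_comp_X_add_C {K ι : Type*} [Field K] {c : ι → K[X]}
    {f : ι → ι} {β : K} (h : ∀ t, ∃ a : K, a ≠ 0 ∧ c (f t) = a • (c t).comp (X + C β))
    (k : ℕ) (t : ι) : ∃ a : K, a ≠ 0 ∧ c (f^[k] t) = a • (c t).comp (X + C (k * β)) := by
  induction k with
  | zero => exact ⟨1, one_ne_zero, by simp⟩
  | succ k ih =>
    obtain ⟨a, ha, hca⟩ := ih
    obtain ⟨b, hb, hcb⟩ := h (f^[k] t)
    refine ⟨b * a, mul_ne_zero hb ha, ?_⟩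
    rw [Function.iterate_succ_apply', hcb, hca, smul_comp, smul_smul, comp_assoc]
    congr 2
    simp only [add_comp, X_comp, C_comp, Nat.cast_succ, add_mul, one_mul, C_add]
    ring

/-- An injective self-map all of whose iterates keep a point in a finite set has that point
as a periodic point. -/
lemma Function.Injective.exists_iterate_eq_self {ι : Type*} {f : ι → ι}
    (hf : Function.Injective f) {s : Set ι} (hs : s.Finite) {t : ι} (ht : ∀ k, f^[k] t ∈ s) :
    ∃ k, 0 < k ∧ f^[k] t = t := by
  obtain ⟨i, j, hij, heq⟩ := hs.exists_lt_map_eq_of_forall_mem ht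
  exact ⟨j - i, Nat.sub_pos_of_lt hij, Function.iterate_cancel hf heq.symm⟩

/-- **Core algebraic claim of Case 2 of Proposition 4.1.** Let `c` be the (finitely
supported) coefficient family of a Laurent polynomial `p(X, Y₁, …, Yₙ) = ∑ₜ cₜ(X)·Yᵗ` over
a field `K` of characteristic `0`, with `cₜ` non-constant for some `t`. If for an injective
additive map `N : ℤⁿ → ℤⁿ`, a vector `u ∈ ℤⁿ`, units `γ : Fin n → Kˣ`, `ξ ∈ Kˣ` and `β ∈ K`
the coefficientwise identity `(∏ᵢ γᵢ^{tᵢ}) • cₜ(X + β) = ξ • c_{N t + u}` holds for every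
`t`, then `β = 0`. -/
theorem shift_eq_zero_of_laurent_identity {K : Type*} [Field K] [CharZero K] (n : ℕ)
    (c : (Fin n → ℤ) →₀ Polynomial K) (hc : ∃ t, 0 < (c t).natDegree)
    (N : (Fin n → ℤ) →+ (Fin n → ℤ)) (hN : Function.Injective ⇑N)
    (u : Fin n → ℤ) (γ : Fin n → Kˣ) (ξ : Kˣ) (β : K)
    (h : ∀ t : Fin n → ℤ,
      ((∏ i, γ i ^ t i : Kˣ) : K) • ((c t).comp (Polynomial.X + Polynomial.C β)) =
        (ξ : K) • c (N t + u)) :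
    β = 0 := by
  obtain ⟨t, ht⟩ := hc
  have hinj : Function.Injective fun t => N t + u := (add_left_injective u).comp hN
  have hstep (t : Fin n → ℤ) : ∃ a : K, a ≠ 0 ∧
      c (N t + u) = a • (c t).comp (Polynomial.X + Polynomial.C β) := by
    refine ⟨(ξ : K)⁻¹ * ((∏ i, γ i ^ t i : Kˣ) : K),
      mul_ne_zero (inv_ne_zero ξ.ne_zero) (Units.ne_zero _), ?_⟩
    rw [mul_smul, h t, inv_smul_smul₀ ξ.ne_zero]
  have hiter := Polynomial.exists_iterate_eq_smul_comp_X_add_C (f := fun t => N t + u) hstep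
  have hmem (k : ℕ) : (fun t => N t + u)^[k] t ∈ (c.support : Set (Fin n → ℤ)) := by
    obtain ⟨a, ha, hca⟩ := hiter k t
    rw [Finset.mem_coe, Finsupp.mem_support_iff, hca]
    refine smul_ne_zero ha (Polynomial.ne_zero_of_natDegree_gt (n := 0) ?_)
    rwa [Polynomial.natDegree_comp, Polynomial.natDegree_X_add_C, mul_one]
  obtain ⟨k, hk, hper⟩ := hinj.exists_iterate_eq_self c.support.finite_toSet hmem
  obtain ⟨a, -, hca⟩ := hiter k t
  rw [hper] at hca
  have hkβ := Polynomial.eq_zero_of_eq_smul_comp_X_add_C ht hca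
  exact (mul_eq_zero.mp hkβ).resolve_left (Nat.cast_ne_zero.mpr hk.ne')
end

section
/- Let m₁, m₂, l₁, l₂ be integers with l₁·m₂ = l₂·m₁, and set d₁ = gcd(l₁, m₁) and d₂ = gcd(l₂, m₂). Then there exist integers u and v such that m₁·u + l₁·v = d₁ and (m₂·u + l₂·v = d₂ or m₂·u + l₂·v = −d₂). -/
/-- **Bézout-type claim from Case 1 of Proposition 4.1.** If `l₁·m₂ = l₂·m₁` and
`dᵢ = gcd(lᵢ, mᵢ)`, then there are integers `u, v` with `m₁·u + l₁·v = d₁` and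
`m₂·u + l₂·v = ±d₂`. -/
theorem exists_bezout_pair (m₁ m₂ l₁ l₂ : ℤ) (h : l₁ * m₂ = l₂ * m₁) :
    ∃ u v : ℤ, m₁ * u + l₁ * v = (Int.gcd l₁ m₁ : ℤ) ∧
      (m₂ * u + l₂ * v = (Int.gcd l₂ m₂ : ℤ) ∨ m₂ * u + l₂ * v = -(Int.gcd l₂ m₂ : ℤ)) := by
  by_cases hd : Int.gcd l₁ m₁ = 0
  · obtain ⟨rfl, rfl⟩ := Int.gcd_eq_zero_iff.mp hd
    refine ⟨Int.gcdB l₂ m₂, Int.gcdA l₂ m₂, by simp, Or.inl ?_⟩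
    rw [Int.gcd_eq_gcd_ab, add_comm]
  · obtain ⟨u, v, huv⟩ : ∃ u v : ℤ, m₁ * u + l₁ * v = (Int.gcd l₁ m₁ : ℤ) :=
      ⟨Int.gcdB l₁ m₁, Int.gcdA l₁ m₁, by rw [Int.gcd_eq_gcd_ab, add_comm]⟩
    refine ⟨u, v, huv, ?_⟩
    have hl : (Int.gcd l₁ m₁ : ℤ) * l₂ = l₁ * (m₂ * u + l₂ * v) := by
      rw [← huv]; linear_combination (-u) * h
    have hm : (Int.gcd l₁ m₁ : ℤ) * m₂ = m₁ * (m₂ * u + l₂ * v) := by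
      rw [← huv]; linear_combination v * h
    have hgcd : Int.gcd l₁ m₁ * Int.gcd l₂ m₂ = Int.gcd l₁ m₁ * (m₂ * u + l₂ * v).natAbs := by
      rw [← Int.gcd_mul_right, ← hl, ← hm, Int.gcd_mul_left, Int.natAbs_natCast]
    rw [Nat.eq_of_mul_eq_mul_left (Nat.pos_of_ne_zero hd) hgcd]
    exact Int.natAbs_eq _
end

section
/- Let K be a field and n ≥ 1. Let R = K[X][Y₁^{±1},…,Yₙ^{±1}] be the ring of Laurent polynomials in Y₁,…,Yₙ with coefficients in the polynomial ring K[X] (i.e. the monoid algebra of (Fin n → ℤ) over K[X]), which contains the polynomial ring K[X, Y₁,…,Yₙ] as a subring. Let p ∈ K[X, Y₁,…,Yₙ] be irreducible with positive degree in X, and let g be a nonzero element of the subring K[Y₁^{±1},…,Yₙ^{±1}] of Laurent polynomials in the Y-variables only (with constant coefficients in K). If g divides p in R, then g is a unit of R. -/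
noncomputable section

open AddMonoidAlgebra

/-- The ring of Laurent polynomials `K[X][Y₁^±1, …, Yₙ^±1]` in the variables `Y₁, …, Yₙ`
with coefficients in the polynomial ring `K[X]`: the monoid algebra of `ℤⁿ = (Fin n → ℤ)`
over `K[X]`. -/
abbrev LaurentRing (K : Type*) [Field K] (n : ℕ) : Type _ :=
  AddMonoidAlgebra (Polynomial K) (Fin n → ℤ)

/-- The inclusion of the polynomial ring `K[X, Y₁, …, Yₙ]` (presented as
`MvPolynomial (Fin (n+1)) K`, with variable `0` playing the role of `X` and variable `i+1`
the role of `Yᵢ`) into the Laurent polynomial ring `K[X][Y₁^±1, …, Yₙ^±1]`. -/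
def polyToLaurent (K : Type*) [Field K] (n : ℕ) :
    MvPolynomial (Fin (n + 1)) K →+* LaurentRing K n :=
  MvPolynomial.eval₂Hom (AddMonoidAlgebra.singleZeroRingHom.comp Polynomial.C)
    (Fin.cases (AddMonoidAlgebra.single 0 Polynomial.X)
      (fun j => AddMonoidAlgebra.single (Pi.single j (1 : ℤ)) 1))

/-- The inclusion of the subring `K[Y₁^±1, …, Yₙ^±1]` of Laurent polynomials in the
`Y`-variables only (with constant coefficients in `K`) into `K[X][Y₁^±1, …, Yₙ^±1]`. -/
def constLaurentToLaurent (K : Type*) [Field K] (n : ℕ) :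
    AddMonoidAlgebra K (Fin n → ℤ) →+* LaurentRing K n :=
  AddMonoidAlgebra.liftNCRingHom
    (AddMonoidAlgebra.singleZeroRingHom.comp Polynomial.C)
    (AddMonoidAlgebra.of (Polynomial K) (Fin n → ℤ))
    (fun _ _ => Commute.all _ _)

section LaurentEmbedding

variable {K : Type*} [Field K] {n : ℕ}

theorem polyToLaurent_monomial (m : Fin (n + 1) →₀ ℕ) (a : K) :
    polyToLaurent K n (MvPolynomial.monomial m a) =
      single (fun j => (m j.succ : ℤ)) (Polynomial.monomial (m 0) a) := by
  have hsum : ∑ j : Fin n, (m j.succ : Fin n → ℤ) * Pi.single j 1 =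
      fun j => (m j.succ : ℤ) := by
    ext j
    simp [Finset.sum_apply, Pi.single_apply]
  simp [polyToLaurent, MvPolynomial.eval₂_monomial, Finsupp.prod_fintype, Fin.prod_univ_succ,
    AddMonoidAlgebra.prod_single, hsum, Polynomial.C_mul_X_pow_eq_monomial]

theorem coeff_polyToLaurent (p : MvPolynomial (Fin (n + 1)) K) (m : Fin (n + 1) →₀ ℕ) :
    ((polyToLaurent K n p).coeff (fun j => (m j.succ : ℤ))).coeff (m 0) =
      MvPolynomial.coeff m p := by
  classical
  induction p using MvPolynomial.induction_on' with
  | add p q hp hq => simp [hp, hq]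
  | monomial u a =>
    rw [polyToLaurent_monomial, MvPolynomial.coeff_monomial, coeff_single, Finsupp.single_apply]
    by_cases h : u = m
    · simp [h]
    · rw [if_neg h]
      split_ifs with h'
      · rw [Polynomial.coeff_monomial, if_neg]
        intro h0
        refine h (Finsupp.ext fun i => ?_)
        cases i using Fin.cases with
        | zero => exact h0
        | succ j => exact_mod_cast congrFun h' j
      · simp

theorem polyToLaurent_injective : Function.Injective (polyToLaurent K n) := by
  intro p q h
  ext m
  rw [← coeff_polyToLaurent, ← coeff_polyToLaurent, h]

/-- The monomial `Y^c`, for a nonnegative exponent vector `c`, in `K[X, Y₁, …, Yₙ]`. -/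
def yMonomial (K : Type*) [Field K] {n : ℕ} (c : Fin n →₀ ℕ) : MvPolynomial (Fin (n + 1)) K :=
  MvPolynomial.monomial (Finsupp.cons 0 c) 1

theorem polyToLaurent_yMonomial (c : Fin n →₀ ℕ) :
    polyToLaurent K n (yMonomial K c) = single (fun j => (c j : ℤ)) 1 := by
  simp [yMonomial, polyToLaurent_monomial]

theorem yMonomial_add (c d : Fin n →₀ ℕ) :
    yMonomial K (c + d) = yMonomial K c * yMonomial K d := by
  apply polyToLaurent_injective
  rw [map_mul]
  simp only [polyToLaurent_yMonomial, single_mul_single, mul_one]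
  congr 1

theorem isUnit_polyToLaurent_yMonomial (c : Fin n →₀ ℕ) :
    IsUnit (polyToLaurent K n (yMonomial K c)) := by
  refine IsUnit.of_mul_eq_one (single (fun j => -(c j : ℤ)) 1) ?_
  rw [polyToLaurent_yMonomial, single_mul_single, one_def]
  congr 1
  · ext j
    simp
  · simp

theorem yMonomial_mem_supported (c : Fin n →₀ ℕ) :
    yMonomial K c ∈ MvPolynomial.supported K ({0}ᶜ : Set (Fin (n + 1))) := by
  rw [MvPolynomial.mem_supported, yMonomial, MvPolynomial.vars_monomial one_ne_zero]
  intro i hi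
  rintro rfl
  simp at hi

/-- `f` becomes the image of a polynomial in `S` after multiplication by some `Y^c`. -/
def ClearsInto (S : Subalgebra K (MvPolynomial (Fin (n + 1)) K)) (f : LaurentRing K n) : Prop :=
  ∃ c : Fin n →₀ ℕ, ∃ H ∈ S, polyToLaurent K n (yMonomial K c) * f = polyToLaurent K n H

theorem ClearsInto.add {S : Subalgebra K (MvPolynomial (Fin (n + 1)) K)}
    (hS : ∀ c, yMonomial K c ∈ S) {f₁ f₂ : LaurentRing K n}
    (h₁ : ClearsInto S f₁) (h₂ : ClearsInto S f₂) : ClearsInto S (f₁ + f₂) := by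
  obtain ⟨c₁, H₁, hH₁, e₁⟩ := h₁
  obtain ⟨c₂, H₂, hH₂, e₂⟩ := h₂
  refine ⟨c₁ + c₂, yMonomial K c₂ * H₁ + yMonomial K c₁ * H₂,
    S.add_mem (S.mul_mem (hS _) hH₁) (S.mul_mem (hS _) hH₂), ?_⟩
  rw [yMonomial_add, map_mul, map_add, map_mul, map_mul, ← e₁, ← e₂]
  ring

theorem clearsInto_zero (S : Subalgebra K (MvPolynomial (Fin (n + 1)) K)) :
    ClearsInto S (0 : LaurentRing K n) :=
  ⟨0, 0, S.zero_mem, by simp⟩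

theorem clearsInto_single {S : Subalgebra K (MvPolynomial (Fin (n + 1)) K)}
    (m : Fin n → ℤ) (k : ℕ) (a : K)
    (hS : ∀ c : Fin n →₀ ℕ, MvPolynomial.monomial (Finsupp.cons k c) a ∈ S) :
    ClearsInto S (single m (Polynomial.monomial k a) : LaurentRing K n) := by
  refine ⟨Finsupp.equivFunOnFinite.symm fun j => (-m j).toNat, _,
    hS (Finsupp.equivFunOnFinite.symm fun j => (m j).toNat), ?_⟩
  rw [polyToLaurent_yMonomial, polyToLaurent_monomial, single_mul_single]
  congr 1
  · ext j
    simp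
    omega
  · simp

theorem clearsInto_top (f : LaurentRing K n) : ClearsInto ⊤ f := by
  have hS : ∀ c : Fin n →₀ ℕ, yMonomial K c ∈
      (⊤ : Subalgebra K (MvPolynomial (Fin (n + 1)) K)) := fun _ => Algebra.mem_top
  induction f using AddMonoidAlgebra.induction_linear with
  | zero => exact clearsInto_zero _
  | add f₁ f₂ h₁ h₂ => exact h₁.add hS h₂
  | single m r =>
    induction r using Polynomial.induction_on' with
    | add p q hp hq =>
      rw [single_add]
      exact hp.add hS hq
    | monomial k a => exact clearsInto_single m k a fun _ => Algebra.mem_top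

theorem clearsInto_constLaurentToLaurent (g : AddMonoidAlgebra K (Fin n → ℤ)) :
    ClearsInto (MvPolynomial.supported K {0}ᶜ) (constLaurentToLaurent K n g) := by
  induction g using AddMonoidAlgebra.induction_linear with
  | zero => simpa using clearsInto_zero _
  | add f₁ f₂ h₁ h₂ =>
    rw [map_add]
    exact h₁.add yMonomial_mem_supported h₂
  | single m a =>
    have h : constLaurentToLaurent K n (single m a) = single m (Polynomial.monomial 0 a) := by
      simp [constLaurentToLaurent]
    rw [h]
    refine clearsInto_single m 0 a fun c => ?_
    have hc : MvPolynomial.monomial (Finsupp.cons 0 c) a = a • yMonomial K c := by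
      simp [yMonomial, MvPolynomial.smul_monomial]
    rw [hc]
    exact Subalgebra.smul_mem _ (yMonomial_mem_supported c) a

end LaurentEmbedding

/-- **Divisibility claim of Case 2 of Proposition 4.1.** Let `p ∈ K[X, Y₁, …, Yₙ]` be
irreducible with positive degree in `X`, and let `g` be a nonzero Laurent polynomial in the
`Y`-variables only, with coefficients in `K`. If `g` divides `p` in the Laurent polynomial
ring `K[X][Y₁^±1, …, Yₙ^±1]`, then `g` is a unit of that ring. -/
theorem isUnit_of_dvd_irreducible_poly {K : Type*} [Field K] (n : ℕ) (hn : 1 ≤ n)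
    (p : MvPolynomial (Fin (n + 1)) K) (hp : Irreducible p)
    (hdeg : 0 < p.degreeOf 0)
    (g : AddMonoidAlgebra K (Fin n → ℤ)) (hg : g ≠ 0)
    (hdvd : constLaurentToLaurent K n g ∣ polyToLaurent K n p) :
    IsUnit (constLaurentToLaurent K n g) := by
  obtain ⟨h, hh⟩ := hdvd
  obtain ⟨c, G, hG, eG⟩ := clearsInto_constLaurentToLaurent g
  obtain ⟨d, H, -, eH⟩ := clearsInto_top h
  have key : G * H = yMonomial K (c + d) * p := by
    apply polyToLaurent_injective
    rw [yMonomial_add, map_mul, map_mul, map_mul, ← eG, ← eH, hh]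
    ring
  have hG0 : G ≠ 0 := by
    rintro rfl
    rw [map_zero, (isUnit_polyToLaurent_yMonomial c).mul_right_eq_zero] at eG
    rw [eG, zero_mul, ← map_zero (polyToLaurent K n)] at hh
    exact hp.ne_zero (polyToLaurent_injective hh)
  have hGdeg : G.degreeOf 0 = 0 := by
    by_contra h0
    exact MvPolynomial.mem_supported.1 hG (MvPolynomial.mem_vars_iff_degreeOf_ne_zero.2 h0) rfl
  have hpG : ¬ p ∣ G := by
    rintro ⟨q, rfl⟩
    rw [MvPolynomial.degreeOf_mul_eq (left_ne_zero_of_mul hG0) (right_ne_zero_of_mul hG0)]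
      at hGdeg
    omega
  obtain ⟨q, rfl⟩ := (hp.prime.dvd_or_dvd (key ▸ dvd_mul_left p _)).resolve_left hpG
  have hGq : G * q = yMonomial K (c + d) :=
    mul_right_cancel₀ hp.ne_zero (by rw [← key]; ring)
  have hu : IsUnit (polyToLaurent K n G) := by
    refine isUnit_of_mul_isUnit_left (y := polyToLaurent K n q) ?_
    rw [← map_mul, hGq]
    exact isUnit_polyToLaurent_yMonomial _
  rw [← eG] at hu
  exact isUnit_of_mul_isUnit_right hu
end
end

section
/- Let F be an exponential field. Then the intersection of any nonempty family of strong ℚ-subspaces of F is again a strong ℚ-subspace of F. Consequently, for every subset B ⊆ F there is a smallest strong ℚ-subspace of F containing B (the strong hull ⌜B⌝ of B, the intersection of all strong ℚ-subspaces containing B ∪ ker(exp)). -/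
noncomputable section

/-- The subfield of `F` generated by `L ∪ exp(L)`. -/
def expField {F : Type*} [Field F] (exp : F → F) (L : Set F) : Subfield F :=
  Subfield.closure (L ∪ exp '' L)

/-- `L` is a *strong* ℚ-subspace of the exponential field `(F, exp)`: the kernel of `exp`
is contained in `L`, and the relative predimension `δ(L'/L) ≥ 0` for every
finite-dimensional ℚ-subspace `L'` of `F`.  Concretely, for every finite tuple `a` which
is ℚ-linearly independent over `L` (i.e. a basis of some `L ⊔ L'` over `L`), the
transcendence degree over `K₁ = ℚ(L, exp L)` of `K₂ = ℚ(L₂, exp L₂)`, where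
`L₂ = L ⊔ span(a)`, is at least the length of `a`; this is witnessed by a tuple of
elements of `K₂` which is algebraically independent over `K₁`. -/
def IsStrong {F : Type*} [Field F] [CharZero F] (exp : F → F) (L : Submodule ℚ F) : Prop :=
  {x : F | exp x = 1} ⊆ (L : Set F) ∧
  ∀ (n : ℕ) (a : Fin n → F),
    LinearIndependent ℚ (fun i => (Submodule.Quotient.mk (a i) : F ⧸ L)) →
    ∃ t : Fin n → F,
      (∀ i, t i ∈ expField exp ((L ⊔ Submodule.span ℚ (Set.range a) : Submodule ℚ F) : Set F)) ∧
      AlgebraicIndependent (expField exp (L : Set F)) t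

theorem expField_mono {F : Type*} [Field F] (exp : F → F) {L M : Set F} (h : L ⊆ M) :
    expField exp L ≤ expField exp M :=
  Subfield.closure_mono (Set.union_subset_union h (Set.image_mono h))

theorem expField_sup_le {F : Type*} [Field F] [CharZero F] {exp : F → F}
    (hexpadd : ∀ x y : F, exp (x + y) = exp x * exp y) (L M : Submodule ℚ F) :
    expField exp ((L ⊔ M : Submodule ℚ F) : Set F) ≤ expField exp L ⊔ expField exp M := by
  have hmem (N : Submodule ℚ F) {x : F} (hx : x ∈ N) : x ∈ expField exp N :=
    Subfield.subset_closure (Or.inl hx)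
  have hexp (N : Submodule ℚ F) {x : F} (hx : x ∈ N) : exp x ∈ expField exp N :=
    Subfield.subset_closure (Or.inr ⟨x, hx, rfl⟩)
  have hl : expField exp L ≤ expField exp L ⊔ expField exp M := le_sup_left
  have hr : expField exp M ≤ expField exp L ⊔ expField exp M := le_sup_right
  refine Subfield.closure_le.mpr (Set.union_subset ?_ ?_)
  · intro x hx
    obtain ⟨l, hL, m, hM, rfl⟩ := Submodule.mem_sup.mp hx
    exact add_mem (hl (hmem L hL)) (hr (hmem M hM))
  · rintro _ ⟨x, hx, rfl⟩
    obtain ⟨l, hL, m, hM, rfl⟩ := Submodule.mem_sup.mp hx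
    rw [hexpadd]
    exact mul_mem (hl (hexp L hL)) (hr (hexp M hM))

/-- The compositum `E ⊔ M` has the same transcendence rank over `E` as its subset `M`. -/
theorem AlgebraicIndependent.exists_mem_of_mem_sup {F : Type*} [Field F] {E M : Subfield F}
    {n : ℕ} {s : Fin n → F} (hs : AlgebraicIndependent E s) (hmem : ∀ i, s i ∈ E ⊔ M) :
    ∃ t : Fin n → F, (∀ i, t i ∈ M) ∧ AlgebraicIndependent E t := by
  let mat := AlgebraicIndependent.matroid E F
  let K : Subfield F :=
    { Subalgebra.algebraicClosure (Algebra.adjoin E (M : Set F)) F with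
      neg_mem' := fun hx => Subalgebra.neg_mem _ hx
      inv_mem' := fun x (hx : IsAlgebraic _ x) => hx.inv }
  have hE : E ≤ K := fun x hx => isAlgebraic_algebraMap
    (algebraMap E (Algebra.adjoin E (M : Set F)) ⟨x, hx⟩)
  have hM : M ≤ K := fun x hx => isAlgebraic_algebraMap
    (⟨x, Algebra.subset_adjoin hx⟩ : Algebra.adjoin E (M : Set F))
  have hsub : Set.range s ⊆ mat.closure M := by
    rw [AlgebraicIndependent.matroid_closure_eq]
    rintro _ ⟨i, rfl⟩
    exact sup_le hE hM (hmem i)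
  have hind : mat.Indep (Set.range s) :=
    AlgebraicIndependent.matroid_indep_iff.mpr hs.to_subtype_range
  have hcard : (Set.range s).encard = n := by
    rw [← Set.image_univ, hs.injective.encard_image]
    simp
  have hrk : (n : ℕ∞) ≤ mat.eRk M := by
    rw [← hcard, ← hind.eRk_eq_encard, ← mat.eRk_closure_eq M]
    exact mat.eRk_mono hsub
  obtain ⟨I, hIM, hI, hIcard⟩ := Matroid.le_eRk_iff.mp hrk
  have hfin : I.Finite := Set.finite_of_encard_eq_coe hIcard
  have : Fintype I := hfin.fintype
  have hc : Fintype.card I = n := by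
    rw [← Set.toFinset_card]
    rw [Set.encard_eq_coe_toFinset_card] at hIcard
    exact_mod_cast hIcard
  let e : Fin n ≃ I := (Fintype.equivFinOfCardEq hc).symm
  refine ⟨fun i => e i, fun i => hIM (e i).2, ?_⟩
  exact (AlgebraicIndependent.matroid_indep_iff.mp hI).comp e e.injective

/-- Algebraically independent tuples over successive subfields concatenate. -/
theorem AlgebraicIndependent.append_of_le {F : Type*} [Field F] {K₁ K₂ : Subfield F}
    (h : K₁ ≤ K₂) {m k : ℕ} {s : Fin m → F} {t : Fin k → F}
    (hs : AlgebraicIndependent K₁ s) (hmem : ∀ i, s i ∈ K₂) (ht : AlgebraicIndependent K₂ t) :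
    AlgebraicIndependent K₁ (Fin.append s t) := by
  let : Algebra K₁ K₂ := (Subfield.inclusion h).toAlgebra
  have : IsScalarTower K₁ K₂ F := IsScalarTower.of_algebraMap_eq fun _ => rfl
  have hs' : AlgebraicIndependent K₁ (fun i => (⟨s i, hmem i⟩ : K₂)) :=
    AlgebraicIndependent.of_comp (IsScalarTower.toAlgHom K₁ K₂ F) hs
  have := hs'.sumElim_comp ht
  rw [← (algebraicIndependent_equiv (finSumFinEquiv.symm.trans (Equiv.sumComm _ _)))] at this
  convert this using 1
  ext i
  refine Fin.addCases (fun i => ?_) (fun i => ?_) i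
  · simp; rfl
  · simp

theorem AlgebraicIndependent.subfield_mono {F ι : Type*} [Field F] {K₁ K₂ : Subfield F}
    (h : K₁ ≤ K₂) {t : ι → F} (ht : AlgebraicIndependent K₂ t) : AlgebraicIndependent K₁ t := by
  let : Algebra K₁ K₂ := (Subfield.inclusion h).toAlgebra
  have : IsScalarTower K₁ K₂ F := IsScalarTower.of_algebraMap_eq fun _ => rfl
  exact ht.restrictScalars (K := K₂) (Subfield.inclusion h).injective

theorem Submodule.finrank_map_mkQ_inf_add {K V : Type*} [Field K] [AddCommGroup V] [Module K V]
    {L M A : Submodule K V} (hLM : L ≤ M) (hLA : L ≤ A) [FiniteDimensional K (A.map L.mkQ)] :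
    Module.finrank K ((A ⊓ M).map L.mkQ) + Module.finrank K (A.map M.mkQ) =
      Module.finrank K (A.map L.mkQ) := by
  let q := Submodule.factor hLM
  have hrange : (q.domRestrict (A.map L.mkQ)).range = A.map M.mkQ := by
    rw [LinearMap.range_domRestrict, ← Submodule.map_comp, Submodule.factor_comp_mk]
  have hker : (q.domRestrict (A.map L.mkQ)).ker.map (A.map L.mkQ).subtype =
      (A ⊓ M).map L.mkQ := by
    rw [LinearMap.ker_domRestrict, Submodule.map_comap_subtype]
    ext x
    obtain ⟨x, rfl⟩ := L.mkQ_surjective x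
    have h (N : Submodule K V) (hN : L ≤ N) : L.mkQ x ∈ N.map L.mkQ ↔ x ∈ N := by
      rw [← Submodule.mem_comap, Submodule.comap_map_mkQ, sup_eq_right.mpr hN]
    rw [Submodule.mem_inf, h A hLA, h _ (le_inf hLA hLM), LinearMap.mem_ker, Submodule.mem_inf]
    simp [q]
  rw [← hrange, ← hker, Submodule.finrank_map_subtype_eq]
  have := (q.domRestrict (A.map L.mkQ)).finrank_range_add_finrank_ker
  omega

theorem Submodule.map_mkQ_eq_bot_iff_le {K V : Type*} [Field K] [AddCommGroup V] [Module K V]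
    (L A : Submodule K V) : A.map L.mkQ = ⊥ ↔ A ≤ L := by
  rw [eq_bot_iff, Submodule.map_le_iff_le_comap, Submodule.comap_bot, Submodule.ker_mkQ]

theorem IsStrong.exists_algebraicIndependent {F : Type*} [Field F] [CharZero F] {exp : F → F}
    {L : Submodule ℚ F} (hL : IsStrong exp L) (A : Submodule ℚ F)
    [FiniteDimensional ℚ (A.map L.mkQ)] {n : ℕ} (hn : Module.finrank ℚ (A.map L.mkQ) = n) :
    ∃ t : Fin n → F, (∀ i, t i ∈ expField exp ((L ⊔ A : Submodule ℚ F) : Set F)) ∧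
      AlgebraicIndependent (expField exp (L : Set F)) t := by
  let b := Module.finBasisOfFinrankEq ℚ (A.map L.mkQ) hn
  choose a ha hab using fun i => Submodule.mem_map.mp (b i).2
  have hli : LinearIndependent ℚ (fun i => (Submodule.Quotient.mk (a i) : F ⧸ L)) := by
    have := b.linearIndependent.map' (A.map L.mkQ).subtype (Submodule.ker_subtype _)
    rwa [show (A.map L.mkQ).subtype ∘ b = fun i => Submodule.Quotient.mk (a i) from
      funext fun i => (hab i).symm] at this
  obtain ⟨t, ht, hind⟩ := hL.2 n a hli
  refine ⟨t, fun i => expField_mono exp ?_ (ht i), hind⟩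
  exact sup_le_sup_left (Submodule.span_le.mpr (Set.range_subset_iff.mpr ha)) L

theorem exists_algebraicIndependent_sInf {F : Type*} [Field F] [CharZero F] {exp : F → F}
    (hexpadd : ∀ x y : F, exp (x + y) = exp x * exp y) {𝒮 : Set (Submodule ℚ F)}
    (hstrong : ∀ L ∈ 𝒮, IsStrong exp L) (n : ℕ) (A : Submodule ℚ F) (hA : sInf 𝒮 ≤ A)
    [FiniteDimensional ℚ (A.map (sInf 𝒮).mkQ)]
    (hn : Module.finrank ℚ (A.map (sInf 𝒮).mkQ) = n) :
    ∃ t : Fin n → F, (∀ i, t i ∈ expField exp (A : Set F)) ∧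
      AlgebraicIndependent (expField exp ((sInf 𝒮 : Submodule ℚ F) : Set F)) t := by
  induction n using Nat.strong_induction_on generalizing A with
  | _ n ih =>
  by_cases hAS : A ≤ sInf 𝒮
  · obtain rfl : n = 0 := by
      rw [← hn, (Submodule.map_mkQ_eq_bot_iff_le _ _).mpr hAS, finrank_bot]
    refine ⟨Fin.elim0, fun i => i.elim0, ?_⟩
    exact algebraicIndependent_empty_type_iff.mpr Subtype.val_injective
  obtain ⟨M, hM, hAM⟩ : ∃ M ∈ 𝒮, ¬ A ≤ M := by
    by_contra! h
    exact hAS (le_sInf h)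
  have hLM : sInf 𝒮 ≤ M := sInf_le hM
  have hsum := Submodule.finrank_map_mkQ_inf_add hLM hA
  have : FiniteDimensional ℚ ((A ⊓ M).map (sInf 𝒮).mkQ) :=
    Submodule.finiteDimensional_of_le (Submodule.map_mono inf_le_left)
  have : FiniteDimensional ℚ (A.map M.mkQ) := by
    rw [← Submodule.factor_comp_mk hLM, Submodule.map_comp]
    infer_instance
  have hpos : 0 < Module.finrank ℚ (A.map M.mkQ) := by
    rw [Module.finrank_pos_iff, Submodule.nontrivial_iff_ne_bot]
    rwa [Ne, Submodule.map_mkQ_eq_bot_iff_le]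
  obtain ⟨s, hs, hsind⟩ := ih _ (by omega) (A ⊓ M) (le_inf hA hLM) rfl
  obtain ⟨u, hu, huind⟩ := (hstrong M hM).exists_algebraicIndependent A rfl
  obtain ⟨t, ht, htind⟩ :=
    huind.exists_mem_of_mem_sup fun i => expField_sup_le hexpadd M A (hu i)
  obtain rfl := hn.symm.trans hsum.symm
  refine ⟨Fin.append s t, fun i => ?_, ?_⟩
  · refine Fin.addCases (fun i => ?_) (fun i => ?_) i
    · rw [Fin.append_left]
      exact expField_mono exp inf_le_left (hs i)
    · rw [Fin.append_right]
      exact ht i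
  · exact hsind.append_of_le (expField_mono exp (le_inf hA hLM)) hs
      (htind.subfield_mono (expField_mono exp inf_le_right))

theorem IsStrong.sInf {F : Type*} [Field F] [CharZero F] {exp : F → F}
    (hexpadd : ∀ x y : F, exp (x + y) = exp x * exp y) {𝒮 : Set (Submodule ℚ F)}
    (hstrong : ∀ L ∈ 𝒮, IsStrong exp L) : IsStrong exp (sInf 𝒮) := by
  refine ⟨fun x hx => Submodule.mem_sInf.mpr fun L hL => (hstrong L hL).1 hx, fun n a ha => ?_⟩
  let L := InfSet.sInf 𝒮
  have hmap : (L ⊔ Submodule.span ℚ (Set.range a)).map L.mkQ =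
      Submodule.span ℚ (Set.range fun i => (Submodule.Quotient.mk (a i) : F ⧸ L)) := by
    rw [Submodule.map_sup, Submodule.mkQ_map_self, bot_sup_eq, Submodule.map_span,
      ← Set.range_comp]
    rfl
  have : FiniteDimensional ℚ ((L ⊔ Submodule.span ℚ (Set.range a)).map L.mkQ) := by
    rw [hmap]
    exact FiniteDimensional.span_of_finite ℚ (Set.finite_range _)
  refine exists_algebraicIndependent_sInf hexpadd hstrong n _ le_sup_left ?_
  rw [hmap, finrank_span_eq_card ha, Fintype.card_fin]

theorem isStrong_top {F : Type*} [Field F] [CharZero F] (exp : F → F) :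
    IsStrong exp (⊤ : Submodule ℚ F) := by
  refine ⟨fun _ _ => trivial, fun n a ha => ?_⟩
  obtain rfl : n = 0 := by
    by_contra hn
    exact ha.ne_zero ⟨0, Nat.pos_of_ne_zero hn⟩ (Subsingleton.elim _ _)
  refine ⟨Fin.elim0, fun i => i.elim0, ?_⟩
  exact algebraicIndependent_empty_type_iff.mpr Subtype.val_injective

/-- **Intersections of strong subspaces are strong, and strong hulls exist.** In any
exponential field `(F, exp)`, the intersection of a nonempty family of strong ℚ-subspaces
is strong; consequently, for every subset `B ⊆ F` there is a smallest strong ℚ-subspace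
`H` of `F` containing `B` — the strong hull of `B`, which is the intersection of all
strong ℚ-subspaces containing `B ∪ ker(exp)`. -/
theorem isStrong_sInf_and_hull_exists {F : Type*} [Field F] [CharZero F] (exp : F → F)
    (hexp0 : exp 0 = 1) (hexpadd : ∀ x y : F, exp (x + y) = exp x * exp y)
    (𝒮 : Set (Submodule ℚ F)) (hne : 𝒮.Nonempty) (hstrong : ∀ L ∈ 𝒮, IsStrong exp L) :
    IsStrong exp (sInf 𝒮) ∧
    ∀ B : Set F, ∃ H : Submodule ℚ F,
      IsStrong exp H ∧ B ⊆ (H : Set F) ∧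
      H = sInf {L : Submodule ℚ F | IsStrong exp L ∧ B ∪ {x : F | exp x = 1} ⊆ (L : Set F)} ∧
      ∀ L : Submodule ℚ F, IsStrong exp L → B ⊆ (L : Set F) → H ≤ L := by
  refine ⟨IsStrong.sInf hexpadd hstrong, fun B => ?_⟩
  refine ⟨_, IsStrong.sInf hexpadd fun L hL => hL.1, ?_, rfl, ?_⟩
  · exact fun x hx => Submodule.mem_sInf.mpr fun L hL => hL.2 (Or.inl hx)
  · exact fun L hL hB => sInf_le ⟨hL, Set.union_subset hB hL.1⟩
end
end

section
/- Let F be an exponential field and let L ⊆ F be a strong ℚ-linear subspace of F. Suppose a ∈ F satisfies a ∉ L and exp(a) ∈ L. Then a is transcendental over the subfield of F generated by L ∪ exp(L). -/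
noncomputable section

theorem exp_nat_smul_eq_pow {F : Type*} [Field F] {exp : F → F} (hexp0 : exp 0 = 1)
    (hexpadd : ∀ x y : F, exp (x + y) = exp x * exp y) (n : ℕ) (x : F) :
    exp (n • x) = exp x ^ n := by
  induction n with
  | zero => simp [hexp0]
  | succ k ih => rw [succ_nsmul, hexpadd, ih, pow_succ]

theorem exp_neg_eq_inv {F : Type*} [Field F] {exp : F → F} (hexp0 : exp 0 = 1)
    (hexpadd : ∀ x y : F, exp (x + y) = exp x * exp y) (x : F) : exp (-x) = (exp x)⁻¹ :=
  eq_inv_of_mul_eq_one_left (by rw [← hexpadd, neg_add_cancel, hexp0])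

/-- If `exp x` is algebraic over a field, so is `exp (q • x)` for every rational `q`. -/
theorem IsAlgebraic.exp_rat_smul {K F : Type*} [Field K] [Field F] [CharZero F] [Algebra K F]
    {exp : F → F} (hexp0 : exp 0 = 1) (hexpadd : ∀ x y : F, exp (x + y) = exp x * exp y)
    {x : F} (hx : IsAlgebraic K (exp x)) (q : ℚ) : IsAlgebraic K (exp (q • x)) := by
  have hint (m : ℤ) : IsAlgebraic K (exp (m • x)) := by
    obtain ⟨n, rfl | rfl⟩ := m.eq_nat_or_neg
    · rw [natCast_zsmul, exp_nat_smul_eq_pow hexp0 hexpadd]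
      exact hx.pow n
    · rw [neg_smul, natCast_zsmul, exp_neg_eq_inv hexp0 hexpadd,
        exp_nat_smul_eq_pow hexp0 hexpadd]
      exact (hx.pow n).inv
  refine IsAlgebraic.of_pow q.den_pos ?_
  rw [← exp_nat_smul_eq_pow hexp0 hexpadd]
  have h : q.den • q • x = q.num • x := by
    rw [← Nat.cast_smul_eq_nsmul ℚ, ← Int.cast_smul_eq_zsmul ℚ, smul_smul, Rat.den_mul_eq_num]
  rw [h]
  exact hint q.num

/-- If `a` and `exp a` are algebraic over `ℚ(L, exp L)`, then so is every element of the
field attached to `L ⊔ span {a}`. -/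
theorem isAlgebraic_of_mem_expField_sup_span {F : Type*} [Field F] [CharZero F] {exp : F → F}
    (hexp0 : exp 0 = 1) (hexpadd : ∀ x y : F, exp (x + y) = exp x * exp y)
    {L : Submodule ℚ F} {a : F} (ha : IsAlgebraic (expField exp (L : Set F)) a)
    (hea : IsAlgebraic (expField exp (L : Set F)) (exp a)) {t : F}
    (ht : t ∈ expField exp ((L ⊔ Submodule.span ℚ {a} : Submodule ℚ F) : Set F)) :
    IsAlgebraic (expField exp (L : Set F)) t := by
  set K := expField exp (L : Set F)
  have hK {x : F} (hx : x ∈ K) : IsAlgebraic K x := isAlgebraic_algebraMap (⟨x, hx⟩ : K)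
  have hexpField : expField exp ((L ⊔ Submodule.span ℚ {a} : Submodule ℚ F) : Set F) ≤
      (algebraicClosure K F).toSubfield := by
    have key {x : F} (hx : x ∈ L ⊔ Submodule.span ℚ {a}) :
        IsAlgebraic K x ∧ IsAlgebraic K (exp x) := by
      obtain ⟨l, hl, y, hy, rfl⟩ := Submodule.mem_sup.1 hx
      obtain ⟨q, rfl⟩ := Submodule.mem_span_singleton.1 hy
      have hlK : l ∈ K := Subfield.subset_closure (Or.inl hl)
      have helK : exp l ∈ K := Subfield.subset_closure (Or.inr ⟨l, hl, rfl⟩)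
      refine ⟨(hK hlK).add ?_, ?_⟩
      · rw [Rat.smul_def]
        exact (hK (SubfieldClass.ratCast_mem K q)).mul ha
      · rw [hexpadd]
        exact (hK helK).mul (hea.exp_rat_smul hexp0 hexpadd q)
    refine Subfield.closure_le.2 ?_
    rintro _ (hx | ⟨x, hx, rfl⟩)
    · exact mem_algebraicClosure_iff.2 (key hx).1
    · exact mem_algebraicClosure_iff.2 (key hx).2
  exact mem_algebraicClosure_iff.1 (hexpField ht)

/-- **Transcendence from strongness (Lemma 5.3).** Let `(F, exp)` be an exponential field
and `L` a strong ℚ-subspace of `F`. If `a ∈ F` satisfies `a ∉ L` and `exp a ∈ L`, then `a`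
is transcendental over the subfield of `F` generated by `L ∪ exp(L)`. -/
theorem transcendental_of_strong {F : Type*} [Field F] [CharZero F] (exp : F → F)
    (hexp0 : exp 0 = 1) (hexpadd : ∀ x y : F, exp (x + y) = exp x * exp y)
    (L : Submodule ℚ F) (hL : IsStrong exp L)
    (a : F) (haL : a ∉ L) (hea : exp a ∈ L) :
    Transcendental (expField exp (L : Set F)) a := by
  intro ha
  have hea' : IsAlgebraic (expField exp (L : Set F)) (exp a) :=
    isAlgebraic_algebraMap
      (⟨exp a, Subfield.subset_closure (Or.inl hea)⟩ : expField exp (L : Set F))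
  obtain ⟨t, ht, hind⟩ := hL.2 1 (fun _ => a) <| by
    rw [linearIndependent_unique_iff]
    simpa [Submodule.Quotient.mk_eq_zero] using haL
  have ht0 := ht 0
  rw [Set.range_const] at ht0
  exact hind.transcendental 0
    (isAlgebraic_of_mem_expField_sup_span hexp0 hexpadd ha hea' ht0)
end
end
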